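/- Fix real numbers ω and τ with 0 < τ < ω ≤ 1/2, and set δ = (ω−τ)(1−ω−τ)/(1 + 2√(τ(1−τ))). Let (n_j) and (w_j) be sequences of positive integers with n_j → ∞ and w_j/n_j → ω, and for each j let C_j ⊆ J^{n_j,w_j} be a constant-weight code with minimum Hamming distance at least 2δ·n_j. Then limsup_j (1/n_j)·log₂|C_j| ≤ h(τ). -/

import Mathlib

open Filter

/-- The binary entropy function (base-2 logarithm). -/
noncomputable def binEnt (x : ℝ) : ℝ := -x * Real.logb 2 x - (1 - x) * Real.logb 2 (1 - x)

/-- The Hamming weight of a binary vector. -/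
def wt {n : ℕ} (x : Fin n → Bool) : ℕ := (Finset.univ.filter fun i => x i = true).card

open Finset in
theorem sum_powersetCard_succ_sum_erase {ι : Type*} [Fintype ι] [DecidableEq ι] (i : ℕ)
    (F : Finset ι → ι → ℝ) :
    ∑ s ∈ powersetCard (i + 1) univ, ∑ a ∈ s, F (s.erase a) a =
      ∑ s ∈ powersetCard i univ, ∑ a ∈ sᶜ, F s a := by
  rw [Finset.sum_sigma', Finset.sum_sigma']
  refine Finset.sum_bij' (fun q _ => ⟨q.1.erase q.2, q.2⟩) (fun q _ => ⟨insert q.2 q.1, q.2⟩)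
    ?_ ?_ ?_ ?_ ?_
  · rintro ⟨s, a⟩ h
    simp only [mem_sigma, mem_powersetCard, subset_univ, true_and, mem_compl] at h ⊢
    refine ⟨?_, notMem_erase a s⟩
    rw [card_erase_of_mem h.2, h.1]
    rfl
  · rintro ⟨s, a⟩ h
    simp only [mem_sigma, mem_powersetCard, subset_univ, true_and, mem_compl] at h ⊢
    refine ⟨?_, mem_insert_self a s⟩
    rw [card_insert_of_notMem h.2, h.1]
  · rintro ⟨s, a⟩ h
    simp only [mem_sigma, mem_powersetCard, subset_univ, true_and] at h
    simp [insert_erase h.2]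
  · rintro ⟨s, a⟩ h
    simp only [mem_sigma, mem_powersetCard, subset_univ, true_and, mem_compl] at h
    simp [erase_insert h.2]
  · rintro ⟨s, a⟩ h
    rfl

/-- The kernel `∑_{|s| = i} ∏_{a ∈ s} u a * v a`. -/
noncomputable def levelKernel {ι : Type*} [Fintype ι] (u v : ι → ℝ) (i : ℕ) : ℝ :=
  ∑ s ∈ Finset.powersetCard i Finset.univ, (∏ a ∈ s, u a) * ∏ a ∈ s, v a

/-- The kernel pairing the products over `s` with those over `s` minus a point. -/
noncomputable def crossKernel {ι : Type*} [Fintype ι] [DecidableEq ι] (u v : ι → ℝ) (i : ℕ) : ℝ :=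
  ∑ s ∈ Finset.powersetCard i Finset.univ,
    ∑ a ∈ s, (∏ b ∈ s.erase a, u b) * ∏ b ∈ s, v b

theorem levelKernel_comm {ι : Type*} [Fintype ι] (u v : ι → ℝ) (i : ℕ) :
    levelKernel u v i = levelKernel v u i := by
  unfold levelKernel
  exact Finset.sum_congr rfl fun s _ => mul_comm _ _

theorem levelKernel_zero {ι : Type*} [Fintype ι] (u v : ι → ℝ) : levelKernel u v 0 = 1 := by
  simp [levelKernel]

theorem levelKernel_self_nonneg {ι : Type*} [Fintype ι] (u : ι → ℝ) (i : ℕ) :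
    0 ≤ levelKernel u u i :=
  Finset.sum_nonneg fun _ _ => mul_self_nonneg _

theorem crossKernel_zero {ι : Type*} [Fintype ι] [DecidableEq ι] (u v : ι → ℝ) :
    crossKernel u v 0 = 0 := by
  simp [crossKernel]

open Finset in
theorem crossKernel_succ {ι : Type*} [Fintype ι] [DecidableEq ι] {u v : ι → ℝ} {α k : ℝ}
    (hv : ∀ a, v a ^ 2 = α * v a + 1) (hvs : ∑ a, v a = α * k) (i : ℕ) :
    crossKernel u v (i + 1) = α * (k - i) * levelKernel u v i - crossKernel v u i := by
  have h1 : crossKernel u v (i + 1) = ∑ s ∈ powersetCard i (univ : Finset ι),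
      ∑ a ∈ sᶜ, ((∏ b ∈ s, u b) * ∏ b ∈ s, v b) * v a := by
    rw [← sum_powersetCard_succ_sum_erase i
      (fun s a => ((∏ b ∈ s, u b) * ∏ b ∈ s, v b) * v a)]
    refine sum_congr rfl fun s _ => sum_congr rfl fun a ha => ?_
    rw [← mul_prod_erase s v ha]
    ring
  rw [h1]
  unfold levelKernel crossKernel
  rw [mul_sum, ← sum_sub_distrib]
  refine sum_congr rfl fun s hs => ?_
  have hc : s.card = i := (mem_powersetCard.1 hs).2
  have h2 : ∑ a ∈ s, ((∏ b ∈ s, u b) * ∏ b ∈ s, v b) * v a =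
      α * i * ((∏ b ∈ s, u b) * ∏ b ∈ s, v b) +
        ∑ a ∈ s, (∏ b ∈ s.erase a, v b) * ∏ b ∈ s, u b := by
    have : ∀ a ∈ s, ((∏ b ∈ s, u b) * ∏ b ∈ s, v b) * v a =
        α * ((∏ b ∈ s, u b) * ∏ b ∈ s, v b) + (∏ b ∈ s.erase a, v b) * ∏ b ∈ s, u b := by
      intro a ha
      rw [← mul_prod_erase s v ha]
      linear_combination (∏ b ∈ s, u b) * (∏ b ∈ s.erase a, v b) * hv a
    rw [sum_congr rfl this, sum_add_distrib, sum_const, hc, nsmul_eq_mul]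
    ring
  have h3 := sum_add_sum_compl s fun a => ((∏ b ∈ s, u b) * ∏ b ∈ s, v b) * v a
  rw [← mul_sum univ, hvs] at h3
  linear_combination h3 - h2

theorem crossKernel_comm {ι : Type*} [Fintype ι] [DecidableEq ι] {u v : ι → ℝ} {α k : ℝ}
    (hu : ∀ a, u a ^ 2 = α * u a + 1) (hus : ∑ a, u a = α * k)
    (hv : ∀ a, v a ^ 2 = α * v a + 1) (hvs : ∑ a, v a = α * k) (i : ℕ) :
    crossKernel u v i = crossKernel v u i := by
  induction i with
  | zero => simp [crossKernel_zero]
  | succ i ih => rw [crossKernel_succ hv hvs, crossKernel_succ hu hus, levelKernel_comm, ih]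

/-- The down term of the three-term relation for `levelKernel`. -/
noncomputable def downKernel {ι : Type*} [Fintype ι] (u v : ι → ℝ) : ℕ → ℝ
  | 0 => 0
  | i + 1 => (Fintype.card ι - i : ℝ) * levelKernel u v i

open Finset in
theorem downKernel_eq {ι : Type*} [Fintype ι] [DecidableEq ι] (u v : ι → ℝ) (i : ℕ) :
    ∑ s ∈ powersetCard i (univ : Finset ι),
      ∑ a ∈ s, ((∏ b ∈ s.erase a, u b) * ∏ b ∈ s.erase a, v b) = downKernel u v i := by
  cases i with
  | zero => simp [downKernel]
  | succ i =>
    rw [sum_powersetCard_succ_sum_erase i (fun s _ => (∏ b ∈ s, u b) * ∏ b ∈ s, v b)]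
    simp only [downKernel, levelKernel, mul_sum]
    refine sum_congr rfl fun s hs => ?_
    have hc : s.card = i := (mem_powersetCard.1 hs).2
    have hle : s.card ≤ Fintype.card ι := card_le_univ s
    rw [sum_const, card_compl, nsmul_eq_mul, Nat.cast_sub hle, hc]

open Finset in
theorem sum_mul_levelKernel {ι : Type*} [Fintype ι] [DecidableEq ι] {u v : ι → ℝ} {α k : ℝ}
    (hu : ∀ a, u a ^ 2 = α * u a + 1) (hus : ∑ a, u a = α * k)
    (hv : ∀ a, v a ^ 2 = α * v a + 1) (hvs : ∑ a, v a = α * k) (i : ℕ) :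
    (∑ a, u a * v a) * levelKernel u v i =
      (i + 1) * levelKernel u v (i + 1) + α ^ 2 * i * levelKernel u v i + downKernel u v i
        + 2 * α * crossKernel u v i := by
  have hup : ∑ s ∈ powersetCard i (univ : Finset ι),
      ∑ a ∈ sᶜ, ((∏ b ∈ s, u b) * ∏ b ∈ s, v b) * (u a * v a) =
        (i + 1) * levelKernel u v (i + 1) := by
    rw [← sum_powersetCard_succ_sum_erase i
      (fun s a => ((∏ b ∈ s, u b) * ∏ b ∈ s, v b) * (u a * v a))]
    unfold levelKernel
    rw [mul_sum]
    refine sum_congr rfl fun s hs => ?_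
    have hc : s.card = i + 1 := (mem_powersetCard.1 hs).2
    have : ∀ a ∈ s, ((∏ b ∈ s.erase a, u b) * ∏ b ∈ s.erase a, v b) * (u a * v a) =
        (∏ b ∈ s, u b) * ∏ b ∈ s, v b := by
      intro a ha
      rw [← mul_prod_erase s v ha, ← mul_prod_erase s u ha]
      ring
    rw [sum_congr rfl this, sum_const, hc, nsmul_eq_mul]
    push_cast
    ring
  have hin : ∑ s ∈ powersetCard i (univ : Finset ι),
      ∑ a ∈ s, ((∏ b ∈ s, u b) * ∏ b ∈ s, v b) * (u a * v a) =
        α ^ 2 * i * levelKernel u v i + downKernel u v i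
          + α * (crossKernel u v i + crossKernel v u i) := by
    rw [← downKernel_eq]
    unfold levelKernel crossKernel
    rw [← sum_add_distrib, mul_sum, mul_sum, ← sum_add_distrib, ← sum_add_distrib]
    refine sum_congr rfl fun s hs => ?_
    have hc : s.card = i := (mem_powersetCard.1 hs).2
    have : ∀ a ∈ s, ((∏ b ∈ s, u b) * ∏ b ∈ s, v b) * (u a * v a) =
        α ^ 2 * ((∏ b ∈ s, u b) * ∏ b ∈ s, v b)
          + (∏ b ∈ s.erase a, u b) * (∏ b ∈ s.erase a, v b)
          + α * ((∏ b ∈ s.erase a, u b) * (∏ b ∈ s, v b)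
            + (∏ b ∈ s.erase a, v b) * ∏ b ∈ s, u b) := by
      intro a ha
      rw [← mul_prod_erase s v ha, ← mul_prod_erase s u ha]
      linear_combination (∏ b ∈ s.erase a, u b) * (∏ b ∈ s.erase a, v b) *
        (v a ^ 2 * hu a + (α * u a + 1) * hv a)
    rw [sum_congr rfl this, sum_add_distrib, sum_add_distrib, sum_const, hc, nsmul_eq_mul,
      ← mul_sum, sum_add_distrib]
    ring
  have hsplit : (∑ a, u a * v a) * levelKernel u v i =
      ∑ s ∈ powersetCard i (univ : Finset ι),
        ∑ a ∈ s, ((∏ b ∈ s, u b) * ∏ b ∈ s, v b) * (u a * v a) +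
      ∑ s ∈ powersetCard i (univ : Finset ι),
        ∑ a ∈ sᶜ, ((∏ b ∈ s, u b) * ∏ b ∈ s, v b) * (u a * v a) := by
    unfold levelKernel
    rw [← sum_add_distrib, mul_sum]
    refine sum_congr rfl fun s _ => ?_
    rw [sum_add_sum_compl s fun a => ((∏ b ∈ s, u b) * ∏ b ∈ s, v b) * (u a * v a), ← mul_sum]
    ring
  rw [hsplit, hup, hin, crossKernel_comm hv hvs hu hus]
  ring

/-- On vectors of the same type, the level kernels depend only on the inner product. -/
theorem levelKernel_congr {ι : Type*} [Fintype ι] [DecidableEq ι] {u v u' v' : ι → ℝ} {α k : ℝ}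
    (hu : ∀ a, u a ^ 2 = α * u a + 1) (hus : ∑ a, u a = α * k)
    (hv : ∀ a, v a ^ 2 = α * v a + 1) (hvs : ∑ a, v a = α * k)
    (hu' : ∀ a, u' a ^ 2 = α * u' a + 1) (hus' : ∑ a, u' a = α * k)
    (hv' : ∀ a, v' a ^ 2 = α * v' a + 1) (hvs' : ∑ a, v' a = α * k)
    (h : ∑ a, u a * v a = ∑ a, u' a * v' a) (i : ℕ) :
    levelKernel u v i = levelKernel u' v' i := by
  suffices H : levelKernel u v i = levelKernel u' v' i ∧
      downKernel u v i = downKernel u' v' i ∧ crossKernel u v i = crossKernel u' v' i from H.1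
  induction i with
  | zero => simp [levelKernel_zero, crossKernel_zero, downKernel]
  | succ i ih =>
    obtain ⟨h1, h2, h3⟩ := ih
    have e := sum_mul_levelKernel hu hus hv hvs i
    have e' := sum_mul_levelKernel hu' hus' hv' hvs' i
    refine ⟨?_, ?_, ?_⟩
    · rw [h, h1, h2, h3, e'] at e
      have hi : (i + 1 : ℝ) ≠ 0 := by positivity
      apply mul_left_cancel₀ hi
      linarith
    · simp [downKernel, h1]
    · rw [crossKernel_succ hv hvs, crossKernel_succ hv' hvs', crossKernel_comm hv hvs hu hus,
        crossKernel_comm hv' hvs' hu' hus', h1, h3]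

open Finset in
theorem sum_mul_crossKernel {ι : Type*} [Fintype ι] [DecidableEq ι] {u v : ι → ℝ} {α k : ℝ}
    (hu : ∀ a, u a ^ 2 = α * u a + 1) (hus : ∑ a, u a = α * k)
    (hv : ∀ a, v a ^ 2 = α * v a + 1) (hvs : ∑ a, v a = α * k) (Y : ℕ → ℝ) (N : ℕ) :
    ∑ i ∈ range N, (Y i + Y (i + 1)) * crossKernel u v i =
      ∑ i ∈ range N, Y (i + 1) * (α * (k - i)) * levelKernel u v i - Y N * crossKernel u v N := by
  induction N with
  | zero => simp [crossKernel_zero]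
  | succ N ih =>
    rw [sum_range_succ, ih, sum_range_succ, crossKernel_succ hv hvs,
      crossKernel_comm hv hvs hu hus]
    ring

open Finset in
theorem sum_mul_sum_levelKernel {ι : Type*} [Fintype ι] [DecidableEq ι] {u v : ι → ℝ} {α : ℝ}
    {k : ℕ} (hu : ∀ a, u a ^ 2 = α * u a + 1) (hus : ∑ a, u a = α * k)
    (hv : ∀ a, v a ^ 2 = α * v a + 1) (hvs : ∑ a, v a = α * k) (g Y : ℕ → ℝ)
    (hg : ∀ m, k < m → g m = 0) (hY : ∀ m, k < m → Y m = 0) (hgY : ∀ m, Y m + Y (m + 1) = g m) :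
    (∑ a, u a * v a) * ∑ i ∈ range (k + 1), g i * levelKernel u v i =
      ∑ m ∈ range (k + 2), (m * g (m - 1) + α ^ 2 * m * g m + (Fintype.card ι - m) * g (m + 1)
        + 2 * α ^ 2 * (k - m) * Y (m + 1)) * levelKernel u v m := by
  have e1 : ∑ i ∈ range (k + 1), g i * ((i + 1) * levelKernel u v (i + 1)) =
      ∑ m ∈ range (k + 2), m * g (m - 1) * levelKernel u v m := by
    rw [sum_range_succ' _ (k + 1)]
    simp only [Nat.cast_zero, zero_mul, add_zero, Nat.add_sub_cancel]
    refine sum_congr rfl fun i _ => ?_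
    push_cast
    ring
  have e2 : ∑ i ∈ range (k + 1), g i * (α ^ 2 * i * levelKernel u v i) =
      ∑ m ∈ range (k + 2), α ^ 2 * m * g m * levelKernel u v m := by
    rw [sum_range_succ _ (k + 1), hg (k + 1) (by omega)]
    simp only [mul_zero, zero_mul, add_zero]
    exact sum_congr rfl fun i _ => by ring
  have e3 : ∑ i ∈ range (k + 1), g i * downKernel u v i =
      ∑ m ∈ range (k + 2), (Fintype.card ι - m) * g (m + 1) * levelKernel u v m := by
    rw [sum_range_succ' _ k, sum_range_succ _ (k + 1), sum_range_succ _ k,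
      hg (k + 1 + 1) (by omega), hg (k + 1) (by omega)]
    simp only [mul_zero, zero_mul, add_zero, downKernel]
    exact sum_congr rfl fun i _ => by ring
  have e4 : ∑ i ∈ range (k + 1), g i * (2 * α * crossKernel u v i) =
      ∑ m ∈ range (k + 2), 2 * α ^ 2 * (k - m) * Y (m + 1) * levelKernel u v m := by
    have h := sum_mul_crossKernel hu hus hv hvs Y (k + 1)
    rw [hY (k + 1) (by omega), zero_mul, sub_zero] at h
    rw [sum_range_succ _ (k + 1), hY (k + 1 + 1) (by omega)]
    simp only [mul_zero, zero_mul, add_zero]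
    have h' := congrArg (fun z => 2 * α * z) h
    simp only [mul_sum] at h'
    refine Eq.trans (sum_congr rfl fun i _ => ?_) (h'.trans (sum_congr rfl fun i _ => ?_))
    · rw [hgY]; ring
    · ring
  rw [mul_sum]
  have : ∀ i ∈ range (k + 1), (∑ a, u a * v a) * (g i * levelKernel u v i) =
      g i * ((i + 1) * levelKernel u v (i + 1)) + g i * (α ^ 2 * i * levelKernel u v i)
        + g i * downKernel u v i + g i * (2 * α * crossKernel u v i) := by
    intro i _
    linear_combination g i * sum_mul_levelKernel hu hus hv hvs i
  rw [sum_congr rfl this]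
  simp only [sum_add_distrib]
  rw [e1, e2, e3, e4]
  simp only [← sum_add_distrib]
  exact sum_congr rfl fun i _ => by ring

open Finset in
theorem sum_sum_kernel_mul_kernel {γ σ ρ : Type*} (C : Finset γ) (S : Finset σ) (T : Finset ρ)
    (a : σ → ℝ) (b : ρ → ℝ) (φ : σ → γ → ℝ) (χ : ρ → γ → ℝ) :
    ∑ x ∈ C, ∑ y ∈ C, (∑ q ∈ S, a q * (φ q x * φ q y)) * (∑ r ∈ T, b r * (χ r x * χ r y)) =
      ∑ q ∈ S, ∑ r ∈ T, a q * b r * (∑ x ∈ C, φ q x * χ r x) ^ 2 := by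
  have h : ∀ q ∈ S, ∀ r ∈ T, a q * b r * (∑ x ∈ C, φ q x * χ r x) ^ 2 =
      ∑ x ∈ C, ∑ y ∈ C, a q * (φ q x * φ q y) * (b r * (χ r x * χ r y)) := by
    intro q _ r _
    rw [sq, sum_mul_sum, mul_sum]
    refine sum_congr rfl fun x _ => ?_
    rw [mul_sum]
    exact sum_congr rfl fun y _ => by ring
  rw [sum_congr rfl fun q hq => sum_congr rfl (h q hq)]
  simp only [sum_mul_sum]
  rw [sum_congr rfl fun x _ => sum_comm, sum_comm]
  refine sum_congr rfl fun q _ => ?_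
  rw [sum_congr rfl fun x _ => sum_comm, sum_comm]

open Finset in
theorem sq_sum_kernel_le {γ σ : Type*} (C : Finset γ) (S : Finset σ)
    (a : σ → ℝ) (ha : ∀ q ∈ S, 0 ≤ a q) (φ : σ → γ → ℝ) :
    (∑ x ∈ C, ∑ q ∈ S, a q * (φ q x * φ q x)) ^ 2 ≤
      S.card * ∑ x ∈ C, ∑ y ∈ C, (∑ q ∈ S, a q * (φ q x * φ q y)) ^ 2 := by
  have h := sum_sum_kernel_mul_kernel C S S a a φ φ
  simp only [← sq] at h
  simp only [sq] at h
  simp only [sq]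
  rw [h, sum_comm]
  simp only [← mul_sum]
  have h1 := sq_sum_le_card_mul_sum_sq (s := S) (f := fun q => a q * ∑ x ∈ C, φ q x * φ q x)
  refine le_trans (le_of_eq (by ring)) (h1.trans ?_)
  refine mul_le_mul_of_nonneg_left (sum_le_sum fun q hq => ?_) (Nat.cast_nonneg _)
  refine le_trans (le_of_eq (by ring)) (single_le_sum (f := fun r => a q * a r *
    ((∑ x ∈ C, φ q x * φ r x) * ∑ x ∈ C, φ q x * φ r x)) (fun r hr => ?_) hq)
  exact mul_nonneg (mul_nonneg (ha q hq) (ha r hr)) (mul_self_nonneg _)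

open Finset in
theorem sum_levelKernel_eq {ι : Type*} [Fintype ι] (u v : ι → ℝ) (g : ℕ → ℝ) (N : ℕ) :
    ∑ i ∈ range N, g i * levelKernel u v i =
      ∑ q ∈ (range N).sigma fun i => powersetCard i (univ : Finset ι),
        g q.1 * ((∏ a ∈ q.2, u a) * ∏ a ∈ q.2, v a) := by
  rw [sum_sigma]
  exact sum_congr rfl fun i _ => by rw [levelKernel, mul_sum]

open Finset in
/-- The spectral form of the linear programming bound. -/
theorem mul_card_le_of_levelKernel {γ ι : Type*} [Fintype ι] [DecidableEq ι] (C : Finset γ)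
    (v : γ → ι → ℝ) {α : ℝ} {k : ℕ} (hv : ∀ x ∈ C, ∀ a, v x a ^ 2 = α * v x a + 1)
    (hvs : ∀ x ∈ C, ∑ a, v x a = α * k) (g d : ℕ → ℝ) (hg : ∀ m, 0 ≤ g m) (hg0 : 0 < g 0)
    (hd : ∀ m, 0 ≤ d m) {lam μ T : ℝ} (hμ : μ ≤ lam) (hT : μ ≤ T)
    (hdec : ∀ x ∈ C, ∀ y ∈ C,
      ((∑ a, v x a * v y a) - lam) * ∑ i ∈ range (k + 1), g i * levelKernel (v x) (v y) i =
        ∑ m ∈ range (k + 2), d m * levelKernel (v x) (v y) m)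
    (hself : ∀ x ∈ C, ∑ a, v x a * v x a = T)
    (hne : ∀ x ∈ C, ∀ y ∈ C, x ≠ y → ∑ a, v x a * v y a ≤ μ) :
    (lam - μ) * C.card ≤ (∑ i ∈ range (k + 1), ((Fintype.card ι).choose i : ℝ)) * (T - μ) := by
  classical
  rcases C.eq_empty_or_nonempty with rfl | ⟨x₀, hx₀⟩
  · simp only [card_empty, Nat.cast_zero, mul_zero]
    exact mul_nonneg (sum_nonneg fun _ _ => Nat.cast_nonneg _) (by linarith)
  set K : γ → γ → ℝ := fun x y => ∑ i ∈ range (k + 1), g i * levelKernel (v x) (v y) i with hK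
  set P := K x₀ x₀ with hP
  have hdiag : ∀ x ∈ C, K x x = P := by
    intro x hx
    refine sum_congr rfl fun i _ => ?_
    rw [levelKernel_congr (hv x hx) (hvs x hx) (hv x hx) (hvs x hx) (hv x₀ hx₀) (hvs x₀ hx₀)
      (hv x₀ hx₀) (hvs x₀ hx₀) (by rw [hself x hx, hself x₀ hx₀])]
  have hPpos : 0 < P := by
    rw [hP, hK]
    simp only
    rw [sum_range_succ' _ k, levelKernel_zero]
    have : 0 ≤ ∑ i ∈ range k, g (i + 1) * levelKernel (v x₀) (v x₀) (i + 1) :=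
      sum_nonneg fun i _ => mul_nonneg (hg _) (levelKernel_self_nonneg _ _)
    linarith
  have hpsd : 0 ≤ ∑ x ∈ C, ∑ y ∈ C, ((∑ a, v x a * v y a) - lam) * K x y * K x y := by
    have : ∀ x ∈ C, ∀ y ∈ C, ((∑ a, v x a * v y a) - lam) * K x y * K x y =
        (∑ m ∈ range (k + 2), d m * levelKernel (v x) (v y) m) *
          ∑ i ∈ range (k + 1), g i * levelKernel (v x) (v y) i := by
      intro x hx y hy
      rw [← hdec x hx y hy]
    rw [sum_congr rfl fun x hx => sum_congr rfl (this x hx)]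
    simp only [sum_levelKernel_eq]
    rw [sum_sum_kernel_mul_kernel C _ _ (fun q : (_ : ℕ) × Finset ι => d q.1)
      (fun q : (_ : ℕ) × Finset ι => g q.1) (fun q x => ∏ a ∈ q.2, v x a)
      (fun q x => ∏ a ∈ q.2, v x a)]
    exact sum_nonneg fun q _ => sum_nonneg fun r _ =>
      mul_nonneg (mul_nonneg (hd _) (hg _)) (sq_nonneg _)
  have hrank : ((C.card : ℝ) * P) ^ 2 ≤ (∑ i ∈ range (k + 1), ((Fintype.card ι).choose i : ℝ)) *
      ∑ x ∈ C, ∑ y ∈ C, K x y ^ 2 := by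
    have h := sq_sum_kernel_le C ((range (k + 1)).sigma fun i => powersetCard i (univ : Finset ι))
      (fun q => g q.1) (fun q _ => hg _) (fun q x => ∏ a ∈ q.2, v x a)
    simp only [← sum_levelKernel_eq] at h
    rw [sum_congr rfl hdiag, sum_const, nsmul_eq_mul, card_sigma] at h
    simpa [card_powersetCard] using h
  have hupper : ∑ x ∈ C, ∑ y ∈ C, ((∑ a, v x a * v y a) - μ) * K x y ^ 2 ≤
      C.card * ((T - μ) * P ^ 2) := by
    rw [← nsmul_eq_mul, ← sum_const]
    refine sum_le_sum fun x hx => ?_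
    rw [← add_sum_erase _ _ hx, hself x hx, hdiag x hx]
    have : ∑ y ∈ C.erase x, ((∑ a, v x a * v y a) - μ) * K x y ^ 2 ≤ 0 := by
      refine sum_nonpos fun y hy => ?_
      have hy' := mem_erase.1 hy
      have := hne x hx y hy'.2 hy'.1.symm
      exact mul_nonpos_of_nonpos_of_nonneg (by linarith) (sq_nonneg _)
    linarith
  have hsum : ∑ x ∈ C, ∑ y ∈ C, ((∑ a, v x a * v y a) - μ) * K x y ^ 2 =
      ∑ x ∈ C, ∑ y ∈ C, ((∑ a, v x a * v y a) - lam) * K x y * K x y +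
        (lam - μ) * ∑ x ∈ C, ∑ y ∈ C, K x y ^ 2 := by
    rw [mul_sum, ← sum_add_distrib]
    refine sum_congr rfl fun x _ => ?_
    rw [mul_sum, ← sum_add_distrib]
    exact sum_congr rfl fun y _ => by ring
  set Q := ∑ x ∈ C, ∑ y ∈ C, K x y ^ 2
  set D := ∑ i ∈ range (k + 1), ((Fintype.card ι).choose i : ℝ)
  have hD : 0 ≤ D := sum_nonneg fun _ _ => Nat.cast_nonneg _
  have hN : (0 : ℝ) < C.card := by exact_mod_cast card_pos.2 ⟨x₀, hx₀⟩
  have h1 : (lam - μ) * Q ≤ C.card * ((T - μ) * P ^ 2) := by linarith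
  have h2 : (lam - μ) * ((C.card : ℝ) * P) ^ 2 ≤ D * (C.card * ((T - μ) * P ^ 2)) :=
    calc (lam - μ) * ((C.card : ℝ) * P) ^ 2 ≤ (lam - μ) * (D * Q) :=
          mul_le_mul_of_nonneg_left hrank (by linarith)
      _ = D * ((lam - μ) * Q) := by ring
      _ ≤ _ := mul_le_mul_of_nonneg_left h1 hD
  have h3 : 0 < (C.card : ℝ) * P ^ 2 := by positivity
  refine le_of_mul_le_mul_right ?_ h3
  nlinarith [h2]

theorem two_mul_add_one_pow_le (p : ℕ) {x : ℝ} (hx : 0 ≤ x) :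
    2 * (x + 1) ^ p ≤ (x + 2) ^ p + x ^ p := by
  induction p with
  | zero => norm_num
  | succ p ih =>
    have h : x ^ p ≤ (x + 2) ^ p := by gcongr; linarith
    have h1 := mul_le_mul_of_nonneg_left ih (by linarith : 0 ≤ x + 1)
    rw [pow_succ, pow_succ, pow_succ]
    nlinarith

theorem sub_mul_pow_le (p : ℕ) {x : ℝ} (hx : 0 ≤ x) :
    (x - p) * (x + 1) ^ p ≤ x ^ (p + 1) := by
  induction p with
  | zero => simp
  | succ p ih =>
    have h1 := mul_le_mul_of_nonneg_left ih hx
    have h2 : 0 ≤ ((p : ℝ) + 1) * (x + 1) ^ p := by positivity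
    rw [pow_succ, pow_succ x (p + 1)]
    push_cast
    nlinarith

/-- The alternating sums `e ^ p - (e - 1) ^ p + (e - 2) ^ p - ⋯`. -/
def altPowSum (p : ℕ) : ℕ → ℝ
  | 0 => 0
  | e + 1 => ((e : ℝ) + 1) ^ p - altPowSum p e

theorem altPowSum_bounds {p : ℕ} (hp : p ≠ 0) (e : ℕ) :
    (e : ℝ) ^ p ≤ 2 * altPowSum p e ∧ 2 * altPowSum p e ≤ ((e : ℝ) + 1) ^ p := by
  induction e with
  | zero => simp [altPowSum, hp]
  | succ e ih =>
    have h := two_mul_add_one_pow_le p (Nat.cast_nonneg (α := ℝ) e)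
    have h2 : ((e : ℝ) + 1 + 1) = e + 2 := by ring
    simp only [altPowSum]
    push_cast
    rw [h2]
    constructor <;> linarith [ih.1, ih.2]

/-- The two-valued vector attached to a binary word. -/
noncomputable def signVec (b : ℝ) {n : ℕ} (x : Fin n → Bool) (a : Fin n) : ℝ :=
  if x a = true then b else -b⁻¹

theorem signVec_sq {b : ℝ} (hb : b ≠ 0) {n : ℕ} (x : Fin n → Bool) (a : Fin n) :
    signVec b x a ^ 2 = (b - b⁻¹) * signVec b x a + 1 := by
  unfold signVec
  split_ifs <;> field_simp <;> ring

theorem sum_signVec (b : ℝ) {n : ℕ} (x : Fin n → Bool) :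
    ∑ a, signVec b x a = wt x * (b + b⁻¹) - n * b⁻¹ := by
  have h : ∀ a, signVec b x a = (if x a = true then b + b⁻¹ else 0) - b⁻¹ := by
    intro a
    unfold signVec
    split_ifs <;> ring
  simp only [h, Finset.sum_sub_distrib, ← Finset.sum_filter, Finset.sum_const, nsmul_eq_mul, wt,
    Finset.card_univ, Fintype.card_fin]

theorem sum_signVec_mul {b : ℝ} {n : ℕ} (x y : Fin n → Bool) :
    ∑ a, signVec b x a * signVec b y a =
      (∑ a, signVec b x a ^ 2) / 2 + (∑ a, signVec b y a ^ 2) / 2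
        - (b + b⁻¹) ^ 2 / 2 * hammingDist x y := by
  have h : ∀ a, signVec b x a * signVec b y a =
      signVec b x a ^ 2 / 2 + signVec b y a ^ 2 / 2
        - (if x a ≠ y a then (b + b⁻¹) ^ 2 / 2 else 0) := by
    intro a
    unfold signVec
    cases x a <;> cases y a <;> simp <;> ring
  simp only [h, Finset.sum_sub_distrib, Finset.sum_add_distrib, ← Finset.sum_filter,
    Finset.sum_const, nsmul_eq_mul, hammingDist, ← Finset.sum_div]
  ring

/-- A finite form of the constant-weight bound; `B` is the squared gap between the two values of
the normalised coordinates, and `L` a lower bound for the eigenvalue-type quantity. -/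
theorem mul_card_le_of_constant_weight {n w k p : ℕ} (hp : p ≠ 0) (hkw : k < w) (hkn : w + k < n)
    {L δ B : ℝ} (hδ : 0 ≤ δ)
    (hB : B = ((n : ℝ) - 2 * k) ^ 2 / ((n - w - k) * (w - k)))
    (hL : ∀ m e : ℕ, m + e = k →
      L * ((e : ℝ) + 1) ^ p ≤ m * ((e : ℝ) + 2) ^ p + (n - m) * (e : ℝ) ^ p)
    (hgap : 0 ≤ L - (B - 4) * p - n + B * (δ * n))
    (C : Finset (Fin n → Bool)) (hwt : ∀ x ∈ C, wt x = w)
    (hdist : ∀ x ∈ C, ∀ y ∈ C, x ≠ y → 2 * δ * (n : ℝ) ≤ hammingDist x y) :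
    (L - (B - 4) * p - n + B * (δ * n)) * C.card ≤
      (∑ i ∈ Finset.range (k + 1), (n.choose i : ℝ)) * (B * (δ * n)) := by
  have hwk : (0 : ℝ) < w - k := by
    have : (k : ℝ) < w := by exact_mod_cast hkw
    linarith
  have hnwk : (0 : ℝ) < n - w - k := by
    have : (w : ℝ) + k < n := by exact_mod_cast hkn
    linarith
  obtain ⟨b, hb, hb2⟩ : ∃ b : ℝ, 0 < b ∧ b ^ 2 * (w - k) = n - w - k := by
    refine ⟨√((n - w - k) / (w - k)), Real.sqrt_pos.2 (div_pos hnwk hwk), ?_⟩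
    rw [Real.sq_sqrt (div_pos hnwk hwk).le, div_mul_cancel₀ _ hwk.ne']
  have hBb : (b + b⁻¹) ^ 2 = B := by
    rw [hB, ← hb2]
    have : (n : ℝ) - 2 * k = b ^ 2 * (w - k) + (w - k) := by linarith
    rw [this]
    field_simp
  set α := b - b⁻¹ with hα
  have hα2 : α ^ 2 = B - 4 := by
    rw [← hBb, hα]
    field_simp
    ring
  have hsq : ∀ x ∈ C, ∀ a, signVec b x a ^ 2 = α * signVec b x a + 1 :=
    fun x _ a => signVec_sq hb.ne' x a
  have hsum : ∀ x ∈ C, ∑ a, signVec b x a = α * k := by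
    intro x hx
    rw [sum_signVec, hwt x hx, hα]
    field_simp
    linear_combination hb2
  have hsumsq : ∀ x ∈ C, ∑ a, signVec b x a ^ 2 = (B - 4) * k + n := by
    intro x hx
    rw [Finset.sum_congr rfl fun a _ => hsq x hx a, Finset.sum_add_distrib, ← Finset.mul_sum,
      hsum x hx, ← hα2]
    simp
    ring
  set g : ℕ → ℝ := fun m => ((k + 1 - m : ℕ) : ℝ) ^ p with hg
  set Y : ℕ → ℝ := fun m => altPowSum p (k + 1 - m) with hY
  have hg_top : ∀ m, k < m → g m = 0 := by
    intro m hm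
    simp [hg, Nat.sub_eq_zero_of_le hm, hp]
  have hY_top : ∀ m, k < m → Y m = 0 := by
    intro m hm
    simp [hY, Nat.sub_eq_zero_of_le hm, altPowSum]
  have hgY : ∀ m, Y m + Y (m + 1) = g m := by
    intro m
    rcases lt_or_ge k m with hm | hm
    · rw [hg_top m hm, hY_top m hm, hY_top (m + 1) (by omega), add_zero]
    · obtain ⟨e, rfl⟩ := Nat.exists_eq_add_of_le hm
      have e1 : m + e + 1 - m = e + 1 := by omega
      have e2 : m + e + 1 - (m + 1) = e := by omega
      simp only [hg, hY, e1, e2, altPowSum]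
      push_cast
      ring
  have hg_nonneg : ∀ m, 0 ≤ g m := fun m => by simp only [hg]; positivity
  have hBnn : 0 ≤ B := by rw [← hBb]; positivity
  set lam := L + (B - 4) * (k - p) with hlam
  set T := (B - 4) * k + n with hT
  set μ := T - B * (δ * n) with hμ
  set d : ℕ → ℝ := fun m => m * g (m - 1) + α ^ 2 * m * g m + (n - m) * g (m + 1)
        + 2 * α ^ 2 * (k - m) * Y (m + 1) - lam * g m with hd
  have hd_nonneg : ∀ m, 0 ≤ d m := by
    intro m
    rcases lt_or_ge k m with hm | hm
    · simp only [hd, hg_top m hm, hg_top (m + 1) (by omega), hY_top (m + 1) (by omega), mul_zero,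
        add_zero, sub_zero]
      exact mul_nonneg (Nat.cast_nonneg _) (hg_nonneg _)
    · obtain ⟨e, he⟩ := Nat.exists_eq_add_of_le hm
      have h0 := hL m e he.symm
      have e1 : k + 1 - m = e + 1 := by omega
      have e2 : k + 1 - (m + 1) = e := by omega
      have h3 : (m : ℝ) * g (m - 1) = m * ((e : ℝ) + 2) ^ p := by
        rcases Nat.eq_zero_or_pos m with rfl | hm0
        · simp
        · have : k + 1 - (m - 1) = e + 2 := by omega
          simp only [hg, this]
          push_cast
          ring
      have h4 := (altPowSum_bounds hp e).1
      have h5 := sub_mul_pow_le p (Nat.cast_nonneg (α := ℝ) e)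
      have hk : (k : ℝ) = m + e := by exact_mod_cast he
      simp only [hd]
      rw [h3]
      simp only [hg, hY, e1, e2]
      push_cast
      have hα0 : 0 ≤ α ^ 2 := sq_nonneg α
      have h6 : (e : ℝ) ^ (p + 1) ≤ 2 * (e * altPowSum p e) := by
        rw [pow_succ]
        nlinarith [Nat.cast_nonneg (α := ℝ) e]
      have h7 : ((e : ℝ) - p) * (e + 1) ^ p ≤ 2 * (e * altPowSum p e) := h5.trans h6
      have h8 := mul_le_mul_of_nonneg_left h7 hα0
      rw [hlam, ← hα2, hk]
      linarith
  have key := mul_card_le_of_levelKernel C (fun x => signVec b x) hsq hsum g d hg_nonneg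
    (by simp only [hg, Nat.sub_zero]; positivity) hd_nonneg (lam := lam) (μ := μ) (T := T)
    (by simp only [hμ, hT, hlam]; linarith)
    (by simp only [hμ]; linarith [mul_nonneg hBnn (mul_nonneg hδ (Nat.cast_nonneg (α := ℝ) n))])
    ?_ ?_ ?_
  · have e1 : lam - μ = L - (B - 4) * p - n + B * (δ * n) := by
      simp only [hμ, hT, hlam]; ring
    have e2 : T - μ = B * (δ * n) := by simp only [hμ]; ring
    rwa [e1, e2, Fintype.card_fin] at key
  · intro x hx y hy
    rw [sub_mul, sum_mul_sum_levelKernel (hsq x hx) (hsum x hx) (hsq y hy) (hsum y hy) g Y hg_top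
      hY_top hgY, Finset.mul_sum]
    have : ∑ i ∈ Finset.range (k + 1), lam * (g i * levelKernel (signVec b x) (signVec b y) i) =
        ∑ i ∈ Finset.range (k + 2), lam * (g i * levelKernel (signVec b x) (signVec b y) i) := by
      rw [Finset.sum_range_succ _ (k + 1), hg_top (k + 1) (by omega)]
      ring
    rw [this, ← Finset.sum_sub_distrib, Fintype.card_fin]
    exact Finset.sum_congr rfl fun m _ => by simp only [hd]; ring
  · intro x hx
    rw [← hsumsq x hx]
    exact Finset.sum_congr rfl fun a _ => (sq _).symm
  · intro x hx y hy hxy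
    have h1 := hdist x hx y hy hxy
    have h2 := mul_le_mul_of_nonneg_left h1 hBnn
    rw [sum_signVec_mul, hsumsq x hx, hsumsq y hy, hBb]
    simp only [hμ, hT]
    linarith

theorem exists_pow_ratio_bound {τ ζ : ℝ} (hτ0 : 0 < τ) (hτ1 : τ < 1 / 2) (hζ0 : 0 < ζ)
    (hζ1 : ζ < 1) :
    ∃ p : ℕ, p ≠ 0 ∧ ∃ N : ℕ, ∀ n k : ℕ, N ≤ n → (k : ℝ) ≤ τ * n → τ * n < k + 1 →
      ∀ m e : ℕ, m + e = k → (2 * √(τ * (1 - τ)) * (1 - ζ) * n) * ((e : ℝ) + 1) ^ p ≤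
        m * ((e : ℝ) + 2) ^ p + (n - m) * (e : ℝ) ^ p := by
  have hs0 : 0 ≤ √(τ * (1 - τ)) := Real.sqrt_nonneg _
  have hs2 : √(τ * (1 - τ)) ^ 2 = τ * (1 - τ) := Real.sq_sqrt (by nlinarith)
  set s := √(τ * (1 - τ))
  have hs1 : 2 * s ≤ 1 := by nlinarith [sq_nonneg (1 - 2 * τ)]
  obtain ⟨p, hp⟩ := exists_nat_gt (16 / (τ ^ 2 * ζ))
  have hpc : (16 : ℝ) < p * (τ ^ 2 * ζ) := (div_lt_iff₀ (by positivity)).1 hp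
  have hp0 : (0 : ℝ) < p := lt_trans (by positivity) hp
  obtain ⟨N, hN⟩ := exists_nat_gt (max (p : ℝ) (p / (ζ ^ 2 * τ)))
  refine ⟨p, by rintro rfl; simp at hp0, N, ?_⟩
  intro n k hn hk1 hk2 m e hme
  have hNn : (N : ℝ) ≤ n := by exact_mod_cast hn
  have hnp : (p : ℝ) ≤ n := (le_max_left _ _).trans (hN.le.trans hNn)
  have hnp2 : (p : ℝ) ≤ n * (ζ ^ 2 * τ) :=
    (div_le_iff₀ (by positivity)).1 ((le_max_right _ _).trans (hN.le.trans hNn))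
  have hn0 : (0 : ℝ) < n := hp0.trans_le hnp
  have hkme : (k : ℝ) = m + e := by exact_mod_cast hme.symm
  set f : ℝ := (e : ℝ) + 1 with hf
  have he0 : (0 : ℝ) ≤ e := Nat.cast_nonneg e
  have hm0 : (0 : ℝ) ≤ m := Nat.cast_nonneg m
  have hf1 : 1 ≤ f := by linarith
  have hf0 : 0 < f := by linarith
  have hinv1 : 1 / f ≤ 1 := by rw [div_le_one hf0]; exact hf1
  have hinv0 : 0 < 1 / f := by positivity
  set A := (1 + 1 / f) ^ p with hA
  set D := (1 - 1 / f) ^ p with hD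
  have hA0 : 0 ≤ A := by positivity
  have hD0 : 0 ≤ D := pow_nonneg (by linarith) p
  have eA : ((e : ℝ) + 2) ^ p = f ^ p * A := by
    rw [hA, ← mul_pow]; congr 1; field_simp; linarith
  have eD : (e : ℝ) ^ p = f ^ p * D := by
    rw [hD, ← mul_pow]; congr 1; field_simp; linarith
  have hDA : D ≤ A := pow_le_pow_left₀ (by linarith) (by linarith) p
  have hAb : 1 + p * (1 / f) ≤ A := one_add_mul_le_pow (by linarith) p
  have hDb : 1 - p * (1 / f) ≤ D := by
    have := one_add_mul_le_pow (a := -(1 / f)) (by linarith) p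
    rw [hD, sub_eq_add_neg 1 (1 / f)]
    linarith
  have hADb : 1 - p * (1 / f) ^ 2 ≤ A * D := by
    have h := one_add_mul_le_pow (a := -(1 / f) ^ 2) (by nlinarith) p
    have h2 : A * D = (1 + -(1 / f) ^ 2) ^ p := by
      rw [hA, hD, ← mul_pow]; congr 1; ring
    rw [h2]
    linarith
  have hmk : (m : ℝ) ≤ τ * n := by linarith
  have hnm : (1 - τ) * n ≤ n - m := by linarith
  have hmf : τ * n - f ≤ m := by linarith
  have hnm0 : 0 ≤ (n : ℝ) - m := le_trans (mul_nonneg (by linarith) hn0.le) hnm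
  suffices H : 2 * s * (1 - ζ) * n ≤ m * A + (n - m) * D by
    have := mul_le_mul_of_nonneg_right H (pow_nonneg hf0.le p)
    rw [eA, eD]
    linarith
  have hL1 : 2 * s * (1 - ζ) * n ≤ (1 - ζ) * n := by
    have h1 : 0 ≤ (1 - ζ) * n := mul_nonneg (by linarith) hn0.le
    have := mul_le_mul_of_nonneg_right hs1 h1
    linarith
  rcases le_or_gt f (τ / 4 * p) with h | h
  · have h1 : 4 / τ ≤ A := by
      refine le_trans ?_ hAb
      have : 4 / τ ≤ p * (1 / f) := by
        rw [mul_one_div, div_le_div_iff₀ hτ0 hf0]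
        linarith
      linarith
    have h2 : τ / 2 * n ≤ m := by
      have h3 := mul_le_mul_of_nonneg_left hnp hτ0.le
      have h4 : 0 < τ * n := mul_pos hτ0 hn0
      linarith
    have h3 : τ / 2 * n * (4 / τ) ≤ m * A :=
      mul_le_mul h2 h1 (by positivity) hm0
    have h4 : τ / 2 * n * (4 / τ) = 2 * n := by field_simp; norm_num
    linarith [mul_nonneg hnm0 hD0, mul_pos hζ0 hn0]
  rcases le_or_gt f (ζ * τ * n) with h' | h'
  · have hm' : (1 - ζ) * (τ * n) ≤ m := by linarith
    have hAD : 1 - ζ ≤ A * D := by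
      refine le_trans ?_ hADb
      have h1 : p * (1 / f) ^ 2 ≤ ζ := by
        rw [div_pow, one_pow, mul_one_div, div_le_iff₀ (by positivity)]
        have h2 : (τ / 4 * p) ^ 2 ≤ f ^ 2 := pow_le_pow_left₀ (by positivity) h.le 2
        have h3 : (p : ℝ) ≤ ζ * (τ / 4 * p) ^ 2 := by
          have := mul_le_mul_of_nonneg_left hpc.le hp0.le
          linarith
        exact h3.trans (mul_le_mul_of_nonneg_left h2 hζ0.le)
      linarith
    have h1 : (1 - ζ) * (τ * n) * ((1 - τ) * n) ≤ m * (n - m) :=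
      mul_le_mul hm' hnm (mul_nonneg (by linarith) hn0.le) hm0
    have h2 : (1 - ζ) * (τ * n) * ((1 - τ) * n) * (1 - ζ) ≤ m * (n - m) * (A * D) :=
      mul_le_mul h1 hAD (by linarith) (mul_nonneg hm0 hnm0)
    refine (sq_le_sq₀ (mul_nonneg (mul_nonneg (by linarith) (by linarith)) hn0.le)
      (add_nonneg (mul_nonneg hm0 hA0) (mul_nonneg hnm0 hD0))).1 ?_
    have h3 : (2 * s * (1 - ζ) * n) ^ 2 = 4 * ((1 - ζ) * (τ * n) * ((1 - τ) * n) * (1 - ζ)) := by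
      linear_combination 4 * (1 - ζ) ^ 2 * (n : ℝ) ^ 2 * hs2
    rw [h3]
    linarith [sq_nonneg (m * A - (n - m) * D)]
  · have h1 : p * (1 / f) ≤ ζ := by
      rw [mul_one_div, div_le_iff₀ hf0]
      have := mul_le_mul_of_nonneg_left h'.le hζ0.le
      linarith
    have h2 : (1 - ζ) * n ≤ D * n := mul_le_mul_of_nonneg_right (by linarith) hn0.le
    linarith [mul_le_mul_of_nonneg_left hDA hm0]

theorem sum_choose_le_two_rpow {τ : ℝ} (hτ0 : 0 < τ) (hτ1 : τ ≤ 1 / 2) {n k : ℕ}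
    (hk : (k : ℝ) ≤ τ * n) :
    ∑ i ∈ Finset.range (k + 1), (n.choose i : ℝ) ≤ (2 : ℝ) ^ ((n : ℝ) * binEnt τ) := by
  have h1τ : 0 < 1 - τ := by linarith
  have hkn : k ≤ n := by
    have : (k : ℝ) ≤ n := hk.trans (by nlinarith [Nat.cast_nonneg (α := ℝ) n])
    exact_mod_cast this
  have hweight : ∀ i ∈ Finset.range (k + 1),
      (2 : ℝ) ^ (-((n : ℝ) * binEnt τ)) ≤ τ ^ i * (1 - τ) ^ (n - i) := by
    intro i hi
    have hik : i ≤ k := Nat.lt_succ_iff.1 (Finset.mem_range.1 hi)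
    have hin : i ≤ n := hik.trans hkn
    have hiτ : (i : ℝ) ≤ τ * n := le_trans (by exact_mod_cast hik) hk
    have e1 : τ ^ i * (1 - τ) ^ (n - i) =
        (2 : ℝ) ^ (i * Real.logb 2 τ + (n - i) * Real.logb 2 (1 - τ)) := by
      rw [Real.rpow_add two_pos, mul_comm (i : ℝ), mul_comm ((n : ℝ) - i), Real.rpow_mul two_pos.le,
        Real.rpow_mul two_pos.le, Real.rpow_logb two_pos (by norm_num) hτ0,
        Real.rpow_logb two_pos (by norm_num) h1τ, Real.rpow_natCast, ← Nat.cast_sub hin,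
        Real.rpow_natCast]
    rw [e1]
    refine Real.rpow_le_rpow_of_exponent_le one_le_two ?_
    have hlog : Real.logb 2 τ ≤ Real.logb 2 (1 - τ) :=
      Real.logb_le_logb_of_le one_lt_two hτ0 (by linarith)
    unfold binEnt
    nlinarith
  have htot : ∑ i ∈ Finset.range (k + 1), (n.choose i : ℝ) * (τ ^ i * (1 - τ) ^ (n - i)) ≤ 1 := by
    have h := add_pow τ (1 - τ) n
    rw [add_sub_cancel, one_pow] at h
    refine le_of_le_of_eq ?_ h.symm
    refine le_trans (Finset.sum_le_sum_of_subset_of_nonneg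
      (Finset.range_subset_range.2 (Nat.succ_le_succ hkn)) fun i _ _ => mul_nonneg
        (Nat.cast_nonneg _) (mul_nonneg (pow_nonneg hτ0.le _) (pow_nonneg h1τ.le _))) ?_
    exact le_of_eq (Finset.sum_congr rfl fun i _ => by ring)
  have h2 : (∑ i ∈ Finset.range (k + 1), (n.choose i : ℝ)) * (2 : ℝ) ^ (-((n : ℝ) * binEnt τ)) ≤
      1 := by
    rw [Finset.sum_mul]
    exact (Finset.sum_le_sum fun i hi =>
      mul_le_mul_of_nonneg_left (hweight i hi) (Nat.cast_nonneg _)).trans htot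
  rw [Real.rpow_neg two_pos.le, ← div_eq_mul_inv, div_le_one (Real.rpow_pos_of_pos two_pos _)] at h2
  exact h2

theorem binEnt_nonneg {x : ℝ} (h0 : 0 ≤ x) (h1 : x ≤ 1) : 0 ≤ binEnt x := by
  have a := Real.logb_nonpos one_lt_two h0 h1
  have b := Real.logb_nonpos one_lt_two (sub_nonneg.2 h1) (by linarith : 1 - x ≤ 1)
  unfold binEnt
  nlinarith

theorem continuousAt_binEnt {x : ℝ} (h0 : 0 < x) (h1 : x < 1) : ContinuousAt binEnt x := by
  unfold binEnt
  have a : ContinuousAt (fun x : ℝ => Real.logb 2 x) x :=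
    (Real.continuousAt_log h0.ne').div_const _
  have b : ContinuousAt (fun x : ℝ => Real.logb 2 (1 - x)) x :=
    ((continuousAt_const.sub continuousAt_id).log (sub_pos.2 h1).ne').div_const _
  exact (continuousAt_id.neg.mul a).sub ((continuousAt_const.sub continuousAt_id).mul b)

theorem two_mul_sqrt_lt_one {τ : ℝ} (hτ0 : 0 < τ) (hτ1 : τ < 1 / 2) : 2 * √(τ * (1 - τ)) < 1 := by
  have hs0 : 0 ≤ √(τ * (1 - τ)) := Real.sqrt_nonneg _
  have hs2 : √(τ * (1 - τ)) ^ 2 = τ * (1 - τ) := Real.sq_sqrt (by nlinarith)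
  nlinarith [sq_pos_of_pos (by linarith : 0 < 1 - 2 * τ)]

theorem one_sub_two_mul_sqrt_lt {ω τ σ δ : ℝ} (hτ0 : 0 < τ) (hτσ : τ < σ) (hσω : σ < ω)
    (hω : ω ≤ 1 / 2) (hδ : δ = (ω - τ) * (1 - ω - τ) / (1 + 2 * √(τ * (1 - τ)))) :
    1 - 2 * √(σ * (1 - σ)) < (1 - 2 * σ) ^ 2 / ((1 - ω - σ) * (ω - σ)) * δ := by
  have hmono : √(τ * (1 - τ)) ≤ √(σ * (1 - σ)) := Real.sqrt_le_sqrt (by nlinarith)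
  have hr0 : 0 ≤ √(τ * (1 - τ)) := Real.sqrt_nonneg _
  have hs2 : √(σ * (1 - σ)) ^ 2 = σ * (1 - σ) := Real.sq_sqrt (by nlinarith)
  have hs1 := two_mul_sqrt_lt_one (hτ0.trans hτσ) (by linarith : σ < 1 / 2)
  set r := √(τ * (1 - τ))
  set s := √(σ * (1 - σ))
  have hP : 0 < (1 - ω - σ) * (ω - σ) := mul_pos (by linarith) (by linarith)
  have hlt : (1 - ω - σ) * (ω - σ) < (ω - τ) * (1 - ω - τ) := by nlinarith
  have hnum : (1 - 2 * σ) ^ 2 = (1 - 2 * s) * (1 + 2 * s) := by nlinarith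
  have h1 : (1 - ω - σ) * (ω - σ) < δ * (1 + 2 * s) := by
    have h2 : δ * (1 + 2 * r) = (ω - τ) * (1 - ω - τ) := by
      rw [hδ, div_mul_cancel₀ _ (by linarith)]
    have h3 : 0 ≤ δ := by
      rw [hδ]
      exact div_nonneg (mul_nonneg (by linarith) (by linarith)) (by linarith)
    nlinarith
  rw [div_mul_eq_mul_div, lt_div_iff₀ hP, hnum]
  have := mul_lt_mul_of_pos_left h1 (by linarith : 0 < 1 - 2 * s)
  linarith

/-- The asymptotic MRRW bound for binary constant-weight codes. -/
theorem mrrw_bound_constant_weight (ω τ : ℝ) (hτ0 : 0 < τ) (hτω : τ < ω) (hω : ω ≤ 1 / 2)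
    (δ : ℝ) (hδ : δ = (ω - τ) * (1 - ω - τ) / (1 + 2 * Real.sqrt (τ * (1 - τ))))
    (n w : ℕ → ℕ) (hnpos : ∀ j, 0 < n j) (hwpos : ∀ j, 0 < w j)
    (hn : Tendsto n atTop atTop)
    (hw : Tendsto (fun j => (w j : ℝ) / (n j : ℝ)) atTop (nhds ω))
    (C : ∀ j : ℕ, Finset (Fin (n j) → Bool))
    (hwt : ∀ j, ∀ x ∈ C j, wt x = w j)
    (hdist : ∀ j, ∀ x ∈ C j, ∀ y ∈ C j, x ≠ y → 2 * δ * (n j : ℝ) ≤ hammingDist x y) :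
    limsup (fun j => (1 / (n j : ℝ)) * Real.logb 2 (C j).card) atTop ≤ binEnt τ := by
  have hδ0 : 0 < δ := by
    rw [hδ]
    exact div_pos (mul_pos (by linarith) (by linarith))
      (by linarith [Real.sqrt_nonneg (τ * (1 - τ))])
  have hcob : IsCoboundedUnder (· ≤ ·) atTop
      fun j => (1 / (n j : ℝ)) * Real.logb 2 (C j).card := by
    refine IsCoboundedUnder.of_frequently_ge (a := 0) (Frequently.of_forall fun j => ?_)
    have : 0 ≤ Real.logb 2 ((C j).card : ℝ) :=
      div_nonneg (Real.log_natCast_nonneg _) (Real.log_nonneg one_le_two)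
    positivity
  refine le_of_forall_pos_le_add fun ε hε => limsup_le_of_le hcob ?_
  obtain ⟨σ, hτσ, hσω, hσε⟩ : ∃ σ, τ < σ ∧ σ < ω ∧ binEnt σ < binEnt τ + ε / 2 := by
    have h1 : ∀ᶠ σ in nhdsWithin τ (Set.Ioi τ), binEnt σ < binEnt τ + ε / 2 :=
      ((continuousAt_binEnt hτ0 (by linarith)).eventually_lt continuousAt_const
        (by linarith)).filter_mono nhdsWithin_le_nhds
    obtain ⟨σ, h, h'⟩ := (h1.and (Ioo_mem_nhdsGT hτω)).exists
    exact ⟨σ, h'.1, h'.2, h⟩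
  have hσ0 : 0 < σ := hτ0.trans hτσ
  have hσ1 : σ < 1 / 2 := by linarith
  have hstrict := one_sub_two_mul_sqrt_lt hτ0 hτσ hσω hω hδ
  have hs1 := two_mul_sqrt_lt_one hσ0 hσ1
  have hs0 : 0 ≤ √(σ * (1 - σ)) := Real.sqrt_nonneg _
  set s := √(σ * (1 - σ))
  set B₀ := (1 - 2 * σ) ^ 2 / ((1 - ω - σ) * (ω - σ)) with hB₀
  set γ := B₀ * δ - (1 - 2 * s) with hγ
  have hγ0 : 0 < γ := by linarith
  have hζ0 : 0 < min (1 / 2) (γ / 2) := by positivity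
  have hζ1 : min (1 / 2) (γ / 2) < 1 := lt_of_le_of_lt (min_le_left _ _) (by norm_num)
  have hζγ : min (1 / 2) (γ / 2) ≤ γ / 2 := min_le_right _ _
  set ζ := min (1 / 2) (γ / 2)
  obtain ⟨p, hp, N, hpN⟩ := exists_pow_ratio_bound hσ0 hσ1 hζ0 hζ1
  set k : ℕ → ℕ := fun j => ⌊σ * (n j : ℝ)⌋₊ with hk
  have hnR : Tendsto (fun j => (n j : ℝ)) atTop atTop := tendsto_natCast_atTop_atTop.comp hn
  have hkn : Tendsto (fun j => (k j : ℝ) / (n j : ℝ)) atTop (nhds σ) :=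
    (tendsto_nat_floor_mul_div_atTop hσ0.le).comp hnR
  have hnR0 : ∀ j, (0 : ℝ) < n j := fun j => by exact_mod_cast hnpos j
  set B : ℕ → ℝ := fun j =>
    ((n j : ℝ) - 2 * k j) ^ 2 / ((n j - w j - k j) * (w j - k j)) with hB
  have hBlim : Tendsto B atTop (nhds B₀) := by
    have h : Tendsto (fun j => (1 - 2 * ((k j : ℝ) / n j)) ^ 2 /
        ((1 - (w j : ℝ) / n j - (k j : ℝ) / n j) * ((w j : ℝ) / n j - (k j : ℝ) / n j)))
        atTop (nhds B₀) :=
      ((tendsto_const_nhds.sub (hkn.const_mul 2)).pow 2).div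
        (((tendsto_const_nhds.sub hw).sub hkn).mul (hw.sub hkn))
        (mul_pos (by linarith) (by linarith)).ne'
    refine h.congr fun j => ?_
    have hj := (hnR0 j).ne'
    have e1 : 1 - 2 * ((k j : ℝ) / n j) = (n j - 2 * k j) / n j := by field_simp
    have e2 : 1 - (w j : ℝ) / n j - (k j : ℝ) / n j = (n j - w j - k j) / n j := by field_simp
    have e3 : (w j : ℝ) / n j - (k j : ℝ) / n j = (w j - k j) / n j := by field_simp
    rw [e1, e2, e3, div_pow, div_mul_div_comm, ← sq, div_div_div_cancel_right₀ (pow_ne_zero 2 hj)]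
  have hinv : Tendsto (fun j => ((n j : ℝ))⁻¹) atTop (nhds 0) := tendsto_inv_atTop_zero.comp hnR
  have hgaplim : Tendsto (fun j => 2 * s * (1 - ζ) - (B j - 4) * p * (n j : ℝ)⁻¹ - 1 + B j * δ)
      atTop (nhds (2 * s * (1 - ζ) - (B₀ - 4) * p * 0 - 1 + B₀ * δ)) :=
    ((tendsto_const_nhds.sub (((hBlim.sub_const 4).mul_const _).mul hinv)).sub_const 1).add
      (hBlim.mul_const δ)
  have hgappos : γ / 4 < 2 * s * (1 - ζ) - (B₀ - 4) * p * 0 - 1 + B₀ * δ := by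
    have : 2 * s * ζ ≤ ζ := by nlinarith
    linarith
  set M := B₀ * δ + 1 with hM
  have hM0 : 0 < M := by linarith
  have hBδ : ∀ᶠ j in atTop, B j * δ < M := (hBlim.mul_const δ).eventually_lt_const (by linarith)
  have hlog : Tendsto (fun j => (n j : ℝ)⁻¹ * Real.logb 2 (4 * M / γ)) atTop (nhds 0) := by
    simpa using hinv.mul_const (Real.logb 2 (4 * M / γ))
  filter_upwards [hgaplim.eventually_const_lt hgappos, hBδ,
    hlog.eventually_lt_const (half_pos hε), hn.eventually_ge_atTop N, hkn.eventually_lt hw hσω,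
    (hw.add hkn).eventually_lt_const (by linarith : ω + σ < 1)] with j hgap hBj hlogj hNj hkw hwk
  have hn0 := hnR0 j
  have hkw' : k j < w j := by
    exact_mod_cast (div_lt_div_iff_of_pos_right hn0).1 hkw
  have hwk' : w j + k j < n j := by
    rw [← add_div, div_lt_one hn0] at hwk
    exact_mod_cast hwk
  have hkσ : (k j : ℝ) ≤ σ * n j := Nat.floor_le (by positivity)
  have hgapeq : 2 * s * (1 - ζ) * n j - (B j - 4) * p - n j + B j * (δ * n j) =
      (2 * s * (1 - ζ) - (B j - 4) * p * (n j : ℝ)⁻¹ - 1 + B j * δ) * n j := by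
    field_simp
  have hgapj : γ / 4 * n j ≤ 2 * s * (1 - ζ) * n j - (B j - 4) * p - n j + B j * (δ * n j) := by
    rw [hgapeq]
    exact mul_le_mul_of_nonneg_right hgap.le hn0.le
  have hbound := mul_card_le_of_constant_weight hp hkw' hwk' hδ0.le (B := B j) rfl
    (hpN (n j) (k j) hNj hkσ (Nat.lt_floor_add_one _)) (le_trans (by positivity) hgapj) (C j)
    (hwt j) (hdist j)
  have hvol := sum_choose_le_two_rpow hσ0 hσ1.le hkσ
  have hcard : ((C j).card : ℝ) ≤ 4 * M / γ * (2 : ℝ) ^ ((n j : ℝ) * binEnt σ) := by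
    have hR : (0 : ℝ) < 2 ^ ((n j : ℝ) * binEnt σ) := Real.rpow_pos_of_pos two_pos _
    set R := (2 : ℝ) ^ ((n j : ℝ) * binEnt σ)
    have h1 : γ / 4 * n j * (C j).card ≤ R * (M * n j) := by
      refine (mul_le_mul_of_nonneg_right hgapj (Nat.cast_nonneg _)).trans (hbound.trans ?_)
      have h2 : B j * (δ * n j) ≤ M * n j := by
        rw [← mul_assoc]
        exact mul_le_mul_of_nonneg_right hBj.le hn0.le
      exact (mul_le_mul_of_nonneg_left h2 (Finset.sum_nonneg fun _ _ => Nat.cast_nonneg _)).trans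
        (mul_le_mul_of_nonneg_right hvol (by positivity))
    have h3 : γ / 4 * (C j).card ≤ R * M := by
      refine le_of_mul_le_mul_right ?_ hn0
      linarith
    rw [div_mul_eq_mul_div, le_div_iff₀ hγ0]
    linarith
  rcases Nat.eq_zero_or_pos (C j).card with h0 | hpos
  · rw [h0, Nat.cast_zero, Real.logb_zero, mul_zero]
    linarith [binEnt_nonneg hτ0.le (by linarith : τ ≤ 1)]
  · have hlogle : Real.logb 2 ((C j).card : ℝ) ≤
        Real.logb 2 (4 * M / γ) + n j * binEnt σ := by
      refine (Real.logb_le_logb_of_le one_lt_two (by exact_mod_cast hpos) hcard).trans_eq ?_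
      rw [Real.logb_mul (by positivity) (Real.rpow_pos_of_pos two_pos _).ne',
        Real.logb_rpow two_pos (by norm_num)]
    rw [one_div]
    refine (mul_le_mul_of_nonneg_left hlogle (inv_nonneg.2 hn0.le)).trans ?_
    rw [mul_add, inv_mul_cancel_left₀ hn0.ne']
    linarith
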